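/- arXiv:2504.09711 — 10 statements merged into one kernel-verified Lean document; each statement's English description precedes it below -/
import Mathlib

section
/- Limit of the input gain under a non-informative input prior: for every sequence (D_k) of symmetric positive definite m×m matrices such that D_k⁻¹ → 0 (in any matrix norm), the gains converge: L(D_k) → 𝓛 := (Gᵀ Cᵀ S⁻¹ C G)⁻¹ Gᵀ Cᵀ S⁻¹ = 𝒯⁻¹ Gᵀ Cᵀ S⁻¹. -/
open Matrix Filter

theorem Matrix.mulVec_injective_of_rank_eq_card {m n K : Type*} [Fintype m] [Fintype n] [Field K]
    {A : Matrix m n K} (hA : A.rank = Fintype.card n) : Function.Injective A.mulVec := by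
  have h := A.mulVecLin.finrank_range_add_finrank_ker
  rw [Module.finrank_fintype_fun_eq_card, ← hA, ← Matrix.rank, Nat.add_eq_left,
    Submodule.finrank_eq_zero] at h
  exact LinearMap.ker_eq_bot.mp h

/-- The push-through identity `D U (S + H D U)⁻¹ = (D⁻¹ + U S⁻¹ H)⁻¹ U S⁻¹`. -/
theorem Matrix.mul_inv_add_mul_mul_eq_inv_add_mul {m p K : Type*} [Fintype m] [DecidableEq m]
    [Fintype p] [DecidableEq p] [Field K] {D : Matrix m m K} {S : Matrix p p K}
    {U : Matrix m p K} {H : Matrix p m K} (hD : IsUnit D.det) (hS : IsUnit S.det)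
    (hSH : IsUnit (S + H * D * U).det) (hT : IsUnit (D⁻¹ + U * S⁻¹ * H).det) :
    D * U * (S + H * D * U)⁻¹ = (D⁻¹ + U * S⁻¹ * H)⁻¹ * (U * S⁻¹) := by
  have key : (D⁻¹ + U * S⁻¹ * H) * (D * U) = U * S⁻¹ * (S + H * D * U) := by
    rw [Matrix.add_mul, Matrix.mul_add, nonsing_inv_mul_cancel_left _ _ hD,
      nonsing_inv_mul_cancel_right _ _ hS]
    simp only [Matrix.mul_assoc]
  rw [← nonsing_inv_mul_cancel_left _ (D * U) hT, key, ← Matrix.mul_assoc,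
    mul_nonsing_inv_cancel_right _ _ hSH]

/-- Limit of the SISE input gain under a non-informative input prior. -/
theorem sise_input_gain_limit
    (n m p : ℕ) (hn : 0 < n) (hm : 0 < m) (hp : 0 < p)
    (C : Matrix (Fin p) (Fin n) ℝ) (G : Matrix (Fin n) (Fin m) ℝ)
    (R : Matrix (Fin p) (Fin p) ℝ) (hR : R.PosDef)
    (X : Matrix (Fin n) (Fin n) ℝ) (hX : X.PosSemidef)
    (S : Matrix (Fin p) (Fin p) ℝ) (hS : S = R + C * X * Cᵀ)
    (T : Matrix (Fin m) (Fin m) ℝ) (hT : T = Gᵀ * Cᵀ * S⁻¹ * C * G)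
    (hrank : (C * G).rank = m)
    (D : ℕ → Matrix (Fin m) (Fin m) ℝ) (hD : ∀ k, (D k).PosDef)
    (hDinv : Tendsto (fun k => (D k)⁻¹) atTop (nhds 0)) :
    Tendsto (fun k => D k * Gᵀ * Cᵀ * (S + C * G * D k * Gᵀ * Cᵀ)⁻¹)
      atTop (nhds (T⁻¹ * (Gᵀ * Cᵀ * S⁻¹))) := by
  have hS_pos : S.PosDef := by
    rw [hS]
    simpa using hR.add_posSemidef (hX.mul_mul_conjTranspose_same C)
  have hT' : T = (C * G)ᵀ * S⁻¹ * (C * G) := by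
    rw [hT, transpose_mul]
    simp only [Matrix.mul_assoc]
  have hT_pos : T.PosDef := by
    rw [hT']
    simpa using hS_pos.inv.conjTranspose_mul_mul_same
      (mulVec_injective_of_rank_eq_card (A := C * G) (by simpa using hrank))
  have gain (k : ℕ) : D k * Gᵀ * Cᵀ * (S + C * G * D k * Gᵀ * Cᵀ)⁻¹
      = ((D k)⁻¹ + T)⁻¹ * (Gᵀ * Cᵀ * S⁻¹) := by
    have hSH : (S + C * G * D k * (C * G)ᵀ).PosDef := by
      simpa using hS_pos.add_posSemidef ((hD k).posSemidef.mul_mul_conjTranspose_same (C * G))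
    have hDT : ((D k)⁻¹ + T).PosDef := (hD k).inv.add hT_pos
    rw [hT'] at hDT ⊢
    have h := mul_inv_add_mul_mul_eq_inv_add_mul (hD k).det_pos.ne'.isUnit
      hS_pos.det_pos.ne'.isUnit hSH.det_pos.ne'.isUnit hDT.det_pos.ne'.isUnit
    simpa only [transpose_mul, Matrix.mul_assoc] using h
  have hinv : ContinuousAt Inv.inv T := continuousAt_matrix_inv T <| by
    simpa only [Ring.inverse_eq_inv'] using continuousAt_inv₀ hT_pos.det_pos.ne'
  have hlim : Tendsto (fun k => (D k)⁻¹ + T) atTop (nhds T) := by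
    simpa using hDinv.add_const T
  simp only [gain]
  have hcont : Continuous fun A : Matrix (Fin m) (Fin m) ℝ => A * (Gᵀ * Cᵀ * S⁻¹) :=
    continuous_id.matrix_mul continuous_const
  exact (hcont.tendsto _).comp (hinv.tendsto.comp hlim)
end

section
/- Decomposition of the Kalman gain in terms of the input gain: for every symmetric positive definite matrix D ∈ ℝ^{m×m}, the Kalman gain K(D) := (X + G D Gᵀ) Cᵀ (S + C G D Gᵀ Cᵀ)⁻¹ satisfies K(D) = G L(D) + X Cᵀ S⁻¹ (I_p − C G L(D)). -/
open Matrix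

/-- Decomposition of the Kalman gain in terms of the input gain. -/
theorem sise_kalman_gain_decomposition
    (n m p : ℕ) (hn : 0 < n) (hm : 0 < m) (hp : 0 < p)
    (C : Matrix (Fin p) (Fin n) ℝ) (G : Matrix (Fin n) (Fin m) ℝ)
    (R : Matrix (Fin p) (Fin p) ℝ) (hR : R.PosDef)
    (X : Matrix (Fin n) (Fin n) ℝ) (hX : X.PosSemidef)
    (S : Matrix (Fin p) (Fin p) ℝ) (hS : S = R + C * X * Cᵀ)
    (hrank : (C * G).rank = m)
    (D : Matrix (Fin m) (Fin m) ℝ) (hD : D.PosDef)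
    (L : Matrix (Fin m) (Fin p) ℝ)
    (hL : L = D * Gᵀ * Cᵀ * (S + C * G * D * Gᵀ * Cᵀ)⁻¹)
    (K : Matrix (Fin n) (Fin p) ℝ)
    (hK : K = (X + G * D * Gᵀ) * Cᵀ * (S + C * G * D * Gᵀ * Cᵀ)⁻¹) :
    K = G * L + X * Cᵀ * S⁻¹ * (1 - C * G * L) := by
  have hS_pos : S.PosDef := by
    rw [hS]
    exact hR.add_posSemidef (by simpa using hX.mul_mul_conjTranspose_same C)
  have hT_pos : (S + C * G * D * Gᵀ * Cᵀ).PosDef :=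
    hS_pos.add_posSemidef (by
      simpa [Matrix.mul_assoc] using hD.posSemidef.mul_mul_conjTranspose_same (C * G))
  have hS_det : IsUnit S.det := (isUnit_iff_isUnit_det S).mp hS_pos.isUnit
  have hT_det : IsUnit (S + C * G * D * Gᵀ * Cᵀ).det :=
    (isUnit_iff_isUnit_det _).mp hT_pos.isUnit
  have residual : 1 - C * G * L = S * (S + C * G * D * Gᵀ * Cᵀ)⁻¹ := by
    rw [sub_eq_iff_eq_add, hL, ← mul_nonsing_inv _ hT_det]
    simp only [Matrix.add_mul, Matrix.mul_assoc]
  rw [residual, Matrix.mul_assoc (X * Cᵀ), nonsing_inv_mul_cancel_left _ _ hS_det, hK, hL]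
  simp only [Matrix.add_mul, Matrix.mul_assoc]
  exact add_comm _ _
end

section
/- Limit of the posterior input covariance under a non-informative input prior: for every sequence (D_k) of symmetric positive definite m×m matrices with D_k⁻¹ → 0, (I_m − L(D_k) C G) D_k → 𝒯⁻¹ = (Gᵀ Cᵀ S⁻¹ C G)⁻¹. -/
open Matrix Filter

namespace Matrix

/-- A matrix of full column rank acts injectively on vectors. -/
theorem mulVec_injective_of_rank_eq_card_s8 {K ι κ : Type*} [Field K] [Fintype κ]
    {A : Matrix ι κ K} (h : A.rank = Fintype.card κ) : Function.Injective A.mulVec := by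
  rw [mulVec_injective_iff, linearIndependent_iff_card_eq_finrank_span, Set.finrank,
    ← rank_eq_finrank_span_cols, h]

/-- The covariance form of the Woodbury identity, for positive definite `D` and `S`. -/
theorem PosDef.sub_gain_mul_eq_inv {ι κ : Type*} [Fintype ι] [DecidableEq ι] [Fintype κ]
    [DecidableEq κ] {D : Matrix κ κ ℝ} {S : Matrix ι ι ℝ} (hD : D.PosDef) (hS : S.PosDef)
    (H : Matrix ι κ ℝ) :
    (1 - D * Hᵀ * (S + H * D * Hᵀ)⁻¹ * H) * D = (D⁻¹ + Hᵀ * S⁻¹ * H)⁻¹ := by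
  have hDD : D⁻¹⁻¹ = D := nonsing_inv_nonsing_inv D ((isUnit_iff_isUnit_det D).1 hD.isUnit)
  have hSS : S⁻¹⁻¹ = S := nonsing_inv_nonsing_inv S ((isUnit_iff_isUnit_det S).1 hS.isUnit)
  have hpos : (S + H * D * Hᵀ).PosDef :=
    hS.add_posSemidef (by simpa using hD.posSemidef.mul_mul_conjTranspose_same H)
  rw [add_mul_mul_inv_eq_sub _ _ _ _ hD.inv.isUnit hS.inv.isUnit
    (by rw [hDD, hSS]; exact hpos.isUnit), hDD, hSS, Matrix.sub_mul, Matrix.one_mul]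

end Matrix

/-- Limit of the posterior input covariance under a non-informative input prior. -/
theorem sise_posterior_input_covariance_limit
    (n m p : ℕ) (hn : 0 < n) (hm : 0 < m) (hp : 0 < p)
    (C : Matrix (Fin p) (Fin n) ℝ) (G : Matrix (Fin n) (Fin m) ℝ)
    (R : Matrix (Fin p) (Fin p) ℝ) (hR : R.PosDef)
    (X : Matrix (Fin n) (Fin n) ℝ) (hX : X.PosSemidef)
    (S : Matrix (Fin p) (Fin p) ℝ) (hS : S = R + C * X * Cᵀ)
    (T : Matrix (Fin m) (Fin m) ℝ) (hT : T = Gᵀ * Cᵀ * S⁻¹ * C * G)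
    (hrank : (C * G).rank = m)
    (D : ℕ → Matrix (Fin m) (Fin m) ℝ) (hD : ∀ k, (D k).PosDef)
    (hDinv : Tendsto (fun k => (D k)⁻¹) atTop (nhds 0)) :
    Tendsto
      (fun k => (1 - (D k * Gᵀ * Cᵀ * (S + C * G * D k * Gᵀ * Cᵀ)⁻¹) * (C * G)) * D k)
      atTop (nhds T⁻¹) := by
  have hSpos : S.PosDef := by
    rw [hS]
    exact hR.add_posSemidef (by simpa using hX.mul_mul_conjTranspose_same C)
  have hTH : T = (C * G)ᵀ * S⁻¹ * (C * G) := by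
    rw [hT, transpose_mul]
    simp only [Matrix.mul_assoc]
  have hTpos : T.PosDef := by
    rw [hTH]
    simpa using hSpos.inv.conjTranspose_mul_mul_same
      (mulVec_injective_of_rank_eq_card_s8 (A := C * G) (by simpa using hrank))
  have heq (k : ℕ) :
      (1 - (D k * Gᵀ * Cᵀ * (S + C * G * D k * Gᵀ * Cᵀ)⁻¹) * (C * G)) * D k =
        ((D k)⁻¹ + T)⁻¹ := by
    rw [hTH, ← (hD k).sub_gain_mul_eq_inv hSpos (C * G), transpose_mul]
    simp only [Matrix.mul_assoc]
  simp only [heq]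
  have hcont : ContinuousAt Inv.inv T := by
    refine continuousAt_matrix_inv T ?_
    rw [Ring.inverse_eq_inv']
    exact continuousAt_inv₀ hTpos.det_pos.ne'
  refine hcont.tendsto.comp ?_
  simpa using hDinv.add_const T
end

section
/- Cross-covariance identity: for every symmetric positive definite matrix D ∈ ℝ^{m×m}, with K(D) := (X + G D Gᵀ) Cᵀ (S + C G D Gᵀ Cᵀ)⁻¹ and 𝒥 = X Cᵀ S⁻¹, it holds that G D − K(D) C G D = (I_n − 𝒥 C) G (D⁻¹ + 𝒯)⁻¹. -/
open Matrix

namespace Matrix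

/-- The cross-covariance identity over a commutative ring, with `B` standing for `Cᵀ` and `H`
for `Gᵀ`. -/
theorem mul_sub_gain_mul_eq {R n m p : Type*} [CommRing R] [Fintype n] [Fintype m] [Fintype p]
    [DecidableEq n] [DecidableEq m] [DecidableEq p]
    (C : Matrix p n R) (B : Matrix n p R) (G : Matrix n m R) (H : Matrix m n R)
    (X : Matrix n n R) (S : Matrix p p R) (D : Matrix m m R)
    (hS : IsUnit S) (hD : IsUnit D) (hW : IsUnit (S + C * G * D * H * B))
    (hP : IsUnit (D⁻¹ + H * B * S⁻¹ * C * G)) :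
    G * D - (X + G * D * H) * B * (S + C * G * D * H * B)⁻¹ * (C * G * D) =
      (1 - X * B * S⁻¹ * C) * G * (D⁻¹ + H * B * S⁻¹ * C * G)⁻¹ := by
  rw [isUnit_iff_isUnit_det] at hS hD hW hP
  set W := S + C * G * D * H * B with hWdef
  set P := D⁻¹ + H * B * S⁻¹ * C * G with hPdef
  have hDP : D * P = 1 + D * (H * B * S⁻¹ * C * G) := by
    rw [hPdef, Matrix.mul_add, mul_nonsing_inv D hD]
  have hWS : W * (S⁻¹ * (C * G)) = C * G * (D * P) := by
    rw [hDP, hWdef, Matrix.add_mul, mul_nonsing_inv_cancel_left _ _ hS]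
    simp only [Matrix.mul_add, Matrix.mul_one, Matrix.mul_assoc]
  have hinv : W⁻¹ * (C * G * (D * P)) = S⁻¹ * (C * G) := by
    rw [← hWS, nonsing_inv_mul_cancel_left _ _ hW]
  have key : (G * D - (X + G * D * H) * B * W⁻¹ * (C * G * D)) * P =
      (1 - X * B * S⁻¹ * C) * G := by
    calc _ = G * (D * P) - (X + G * D * H) * B * (W⁻¹ * (C * G * (D * P))) := by
          simp only [Matrix.sub_mul, Matrix.mul_assoc]
      _ = _ := by
          rw [hinv, hDP]
          simp only [Matrix.mul_add, Matrix.add_mul, Matrix.sub_mul, Matrix.mul_one,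
            Matrix.one_mul, Matrix.mul_assoc]
          abel
  rw [← key, mul_nonsing_inv_cancel_right _ _ hP]

end Matrix

/-- Cross-covariance identity. -/
theorem sise_cross_covariance_identity
    (n m p : ℕ) (hn : 0 < n) (hm : 0 < m) (hp : 0 < p)
    (C : Matrix (Fin p) (Fin n) ℝ) (G : Matrix (Fin n) (Fin m) ℝ)
    (R : Matrix (Fin p) (Fin p) ℝ) (hR : R.PosDef)
    (X : Matrix (Fin n) (Fin n) ℝ) (hX : X.PosSemidef)
    (S : Matrix (Fin p) (Fin p) ℝ) (hS : S = R + C * X * Cᵀ)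
    (T : Matrix (Fin m) (Fin m) ℝ) (hT : T = Gᵀ * Cᵀ * S⁻¹ * C * G)
    (J : Matrix (Fin n) (Fin p) ℝ) (hJ : J = X * Cᵀ * S⁻¹)
    (hrank : (C * G).rank = m)
    (D : Matrix (Fin m) (Fin m) ℝ) (hD : D.PosDef)
    (K : Matrix (Fin n) (Fin p) ℝ)
    (hK : K = (X + G * D * Gᵀ) * Cᵀ * (S + C * G * D * Gᵀ * Cᵀ)⁻¹) :
    G * D - K * (C * G * D) = (1 - J * C) * G * (D⁻¹ + T)⁻¹ := by
  subst hS hT hJ hK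
  have hCX : (C * X * Cᵀ).PosSemidef := by
    simpa using hX.mul_mul_conjTranspose_same C
  have hS : (R + C * X * Cᵀ).PosDef := hR.add_posSemidef hCX
  have hCGD : (C * G * D * Gᵀ * Cᵀ).PosSemidef := by
    simpa [Matrix.mul_assoc] using hD.posSemidef.mul_mul_conjTranspose_same (C * G)
  have hT : (Gᵀ * Cᵀ * (R + C * X * Cᵀ)⁻¹ * C * G).PosSemidef := by
    simpa [Matrix.mul_assoc] using hS.inv.posSemidef.conjTranspose_mul_mul_same (C * G)
  exact mul_sub_gain_mul_eq C Cᵀ G Gᵀ X _ D hS.isUnit hD.isUnit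
    (hS.add_posSemidef hCGD).isUnit (hD.inv.add_posSemidef hT).isUnit
end

section
/- Limit of the posterior state covariance under a non-informative input prior: for every sequence (D_k) of symmetric positive definite m×m matrices with D_k⁻¹ → 0, with K(D) := (X + G D Gᵀ) Cᵀ (S + C G D Gᵀ Cᵀ)⁻¹, it holds that (I_n − K(D_k) C)(X + G D_k Gᵀ) → (I_n − 𝒥 C)(X − G 𝓛 C X + G 𝒯⁻¹ Gᵀ), where 𝓛 = 𝒯⁻¹ Gᵀ Cᵀ S⁻¹ and 𝒥 = X Cᵀ S⁻¹. -/
open Matrix Filter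

theorem Matrix.mulVec_injective_of_rank_eq {p m : ℕ} {F : Matrix (Fin p) (Fin m) ℝ}
    (h : F.rank = m) : Function.Injective F.mulVec := by
  rw [Matrix.mulVec_injective_iff, linearIndependent_iff_card_eq_finrank_span, Fintype.card_fin,
    Set.finrank, ← Matrix.rank_eq_finrank_span_cols, h]

/-- The gain equals the gain `J` of the known-input filter plus a correction that depends on `D`
only through `M = (D⁻¹ + T)⁻¹`. The resulting covariance does, too. -/
theorem Matrix.posterior_covariance_eq {n m p : ℕ}
    {C : Matrix (Fin p) (Fin n) ℝ} {G : Matrix (Fin n) (Fin m) ℝ}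
    {X : Matrix (Fin n) (Fin n) ℝ} {S : Matrix (Fin p) (Fin p) ℝ}
    {T D : Matrix (Fin m) (Fin m) ℝ} (hT : T = Gᵀ * Cᵀ * S⁻¹ * C * G)
    (hS : IsUnit S.det) (hD : IsUnit D.det) (hM : IsUnit (D⁻¹ + T).det)
    (hW : IsUnit (S + C * G * D * Gᵀ * Cᵀ).det) :
    (1 - ((X + G * D * Gᵀ) * Cᵀ * (S + C * G * D * Gᵀ * Cᵀ)⁻¹) * C) * (X + G * D * Gᵀ) =
      (1 - X * Cᵀ * S⁻¹ * C) *
        (X - G * ((D⁻¹ + T)⁻¹ * (Gᵀ * Cᵀ * S⁻¹)) * (C * X) + G * (D⁻¹ + T)⁻¹ * Gᵀ) := by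
  set M := (D⁻¹ + T)⁻¹ with hMdef
  have hMD : M * T * D = D - M := by
    have h : M * (D⁻¹ + T) * D = D := by
      rw [hMdef, Matrix.nonsing_inv_mul _ hM, Matrix.one_mul]
    rw [Matrix.mul_add, Matrix.add_mul, Matrix.mul_assoc M D⁻¹ D, Matrix.nonsing_inv_mul _ hD,
      Matrix.mul_one] at h
    exact eq_sub_of_add_eq' h
  set J := X * Cᵀ * S⁻¹ with hJ
  have hJS : J * S = X * Cᵀ := by
    rw [hJ, Matrix.mul_assoc, Matrix.nonsing_inv_mul _ hS, Matrix.mul_one]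
  set H := Gᵀ * Cᵀ * S⁻¹ with hH
  have hHS : H * S = Gᵀ * Cᵀ := by
    rw [hH, Matrix.mul_assoc, Matrix.nonsing_inv_mul _ hS, Matrix.mul_one]
  have hHT : H * C * G = T := hT.symm
  have hK : (X + G * D * Gᵀ) * Cᵀ * (S + C * G * D * Gᵀ * Cᵀ)⁻¹ =
      J + (1 - J * C) * G * M * H := by
    have h : (J + (1 - J * C) * G * M * H) * (S + C * G * D * Gᵀ * Cᵀ) =
        (X + G * D * Gᵀ) * Cᵀ := by
      calc (J + (1 - J * C) * G * M * H) * (S + C * G * D * Gᵀ * Cᵀ)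
          = J * S + J * C * G * D * Gᵀ * Cᵀ + (1 - J * C) * G * M * (H * S)
            + (1 - J * C) * G * (M * (H * C * G) * D) * Gᵀ * Cᵀ := by
            simp only [Matrix.add_mul, Matrix.mul_add, Matrix.mul_assoc]; abel
        _ = (X + G * D * Gᵀ) * Cᵀ := by
            rw [hJS, hHS, hHT, hMD]
            simp only [Matrix.add_mul, Matrix.sub_mul, Matrix.mul_sub, Matrix.one_mul,
              Matrix.mul_assoc]
            abel
    rw [← h, Matrix.mul_assoc, Matrix.mul_nonsing_inv _ hW, Matrix.mul_one]
  rw [hK]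
  calc (1 - (J + (1 - J * C) * G * M * H) * C) * (X + G * D * Gᵀ)
      = (1 - J * C) * (X + G * D * Gᵀ - G * (M * H) * (C * X)
          - G * (M * (H * C * G) * D) * Gᵀ) := by
        simp only [Matrix.add_mul, Matrix.mul_add, Matrix.sub_mul, Matrix.mul_sub, Matrix.one_mul,
          Matrix.mul_assoc]
        abel
    _ = (1 - J * C) * (X - G * (M * H) * (C * X) + G * M * Gᵀ) := by
        rw [hHT, hMD]
        congr 1
        simp only [Matrix.sub_mul, Matrix.mul_sub, Matrix.mul_assoc]
        abel

/-- Limit of the posterior state covariance under a non-informative input prior. -/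
theorem sise_posterior_state_covariance_limit
    (n m p : ℕ) (hn : 0 < n) (hm : 0 < m) (hp : 0 < p)
    (C : Matrix (Fin p) (Fin n) ℝ) (G : Matrix (Fin n) (Fin m) ℝ)
    (R : Matrix (Fin p) (Fin p) ℝ) (hR : R.PosDef)
    (X : Matrix (Fin n) (Fin n) ℝ) (hX : X.PosSemidef)
    (S : Matrix (Fin p) (Fin p) ℝ) (hS : S = R + C * X * Cᵀ)
    (T : Matrix (Fin m) (Fin m) ℝ) (hT : T = Gᵀ * Cᵀ * S⁻¹ * C * G)
    (hrank : (C * G).rank = m)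
    (L : Matrix (Fin m) (Fin p) ℝ) (hL : L = T⁻¹ * (Gᵀ * Cᵀ * S⁻¹))
    (J : Matrix (Fin n) (Fin p) ℝ) (hJ : J = X * Cᵀ * S⁻¹)
    (D : ℕ → Matrix (Fin m) (Fin m) ℝ) (hD : ∀ k, (D k).PosDef)
    (hDinv : Tendsto (fun k => (D k)⁻¹) atTop (nhds 0)) :
    Tendsto
      (fun k =>
        (1 - ((X + G * D k * Gᵀ) * Cᵀ * (S + C * G * D k * Gᵀ * Cᵀ)⁻¹) * C) *
          (X + G * D k * Gᵀ))
      atTop (nhds ((1 - J * C) * (X - G * L * (C * X) + G * T⁻¹ * Gᵀ))) := by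
  have hSpos : S.PosDef := by
    rw [hS]
    exact hR.add_posSemidef (by simpa using hX.mul_mul_conjTranspose_same C)
  have hTpos : T.PosDef := by
    have h := hSpos.inv.conjTranspose_mul_mul_same (Matrix.mulVec_injective_of_rank_eq hrank)
    rw [hT]
    simpa [Matrix.mul_assoc] using h
  have hM : Tendsto (fun k => ((D k)⁻¹ + T)⁻¹) atTop (nhds T⁻¹) := by
    have h : Tendsto (fun k => (D k)⁻¹ + T) atTop (nhds T) := by
      simpa using hDinv.add_const T
    have hinv : ContinuousAt Ring.inverse T.det := by
      rw [Ring.inverse_eq_inv']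
      exact continuousAt_inv₀ hTpos.det_pos.ne'
    exact (continuousAt_matrix_inv T hinv).tendsto.comp h
  have hlim : Tendsto (fun k => (1 - J * C) *
      (X - G * (((D k)⁻¹ + T)⁻¹ * (Gᵀ * Cᵀ * S⁻¹)) * (C * X) + G * ((D k)⁻¹ + T)⁻¹ * Gᵀ)) atTop
      (nhds ((1 - J * C) * (X - G * L * (C * X) + G * T⁻¹ * Gᵀ))) := by
    rw [hL]
    have hc : Continuous fun M : Matrix (Fin m) (Fin m) ℝ => (1 - J * C) *
        (X - G * (M * (Gᵀ * Cᵀ * S⁻¹)) * (C * X) + G * M * Gᵀ) := by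
      fun_prop
    exact (hc.tendsto T⁻¹).comp hM
  refine hlim.congr fun k => ?_
  have hWpos : (S + C * G * D k * Gᵀ * Cᵀ).PosDef := by
    refine hSpos.add_posSemidef ?_
    simpa [Matrix.mul_assoc] using (hD k).posSemidef.mul_mul_conjTranspose_same (C * G)
  rw [hJ]
  exact (Matrix.posterior_covariance_eq hT hSpos.det_pos.ne'.isUnit (hD k).det_pos.ne'.isUnit
    ((hD k).inv.add hTpos).det_pos.ne'.isUnit hWpos.det_pos.ne'.isUnit).symm
end

section
/- Cancellation of the prior input mean in the limit: for every sequence (D_k) of symmetric positive definite m×m matrices with D_k⁻¹ → 0, with K(D) := (X + G D Gᵀ) Cᵀ (S + C G D Gᵀ Cᵀ)⁻¹, it holds that K(D_k) C G → G. -/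
open Matrix Filter

/-- The push-through form of the gain applied to `F`, with deviation from `G` explicit. -/
theorem Matrix.gain_mul_eq {n m p : Type*} [Fintype n] [Fintype m] [Fintype p]
    [DecidableEq m] [DecidableEq p]
    (C : Matrix p n ℝ) (G : Matrix n m ℝ) (X : Matrix n n ℝ) (S : Matrix p p ℝ)
    (D : Matrix m m ℝ) (hS : IsUnit S.det) (hD : IsUnit D.det)
    (hW : IsUnit (S + C * G * D * Gᵀ * Cᵀ).det)
    (hE : IsUnit (D⁻¹ + (C * G)ᵀ * S⁻¹ * (C * G)).det) :
    ((X + G * D * Gᵀ) * Cᵀ * (S + C * G * D * Gᵀ * Cᵀ)⁻¹) * (C * G) =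
      G + (X * Cᵀ * S⁻¹ * (C * G) - G) * (D⁻¹ + (C * G)ᵀ * S⁻¹ * (C * G))⁻¹ * D⁻¹ := by
  set F := C * G with hF
  set M := Fᵀ * S⁻¹ * F with hM
  have hFt : Gᵀ * Cᵀ = Fᵀ := by rw [hF, transpose_mul]
  have hDM : 1 + D * M = D * (D⁻¹ + M) := by rw [Matrix.mul_add, mul_nonsing_inv _ hD]
  have hcancel : D * (D⁻¹ + M) * ((D⁻¹ + M)⁻¹ * D⁻¹) = 1 := by
    rw [Matrix.mul_assoc, mul_nonsing_inv_cancel_left _ _ hE, mul_nonsing_inv _ hD]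
  have hpush : (S + F * D * Gᵀ * Cᵀ)⁻¹ * F = S⁻¹ * F * ((D⁻¹ + M)⁻¹ * D⁻¹) := by
    have h : (S + F * D * Gᵀ * Cᵀ) * (S⁻¹ * F * ((D⁻¹ + M)⁻¹ * D⁻¹)) = F := by
      calc _ = F * ((1 + D * M) * ((D⁻¹ + M)⁻¹ * D⁻¹)) := by
            rw [Matrix.mul_assoc (F * D), hFt, ← Matrix.mul_assoc, Matrix.add_mul,
              mul_nonsing_inv_cancel_left _ _ hS, hM]
            simp only [Matrix.mul_add, Matrix.add_mul, Matrix.mul_assoc, Matrix.one_mul]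
        _ = F := by rw [hDM, hcancel, Matrix.mul_one]
    calc _ = (S + F * D * Gᵀ * Cᵀ)⁻¹ *
          ((S + F * D * Gᵀ * Cᵀ) * (S⁻¹ * F * ((D⁻¹ + M)⁻¹ * D⁻¹))) := by rw [h]
      _ = _ := nonsing_inv_mul_cancel_left _ _ hW
  have hDM' : D * M * ((D⁻¹ + M)⁻¹ * D⁻¹) = 1 - (D⁻¹ + M)⁻¹ * D⁻¹ := by
    rw [eq_sub_iff_add_eq', ← hcancel, ← hDM, Matrix.add_mul, Matrix.one_mul]
  calc _ = X * Cᵀ * S⁻¹ * F * ((D⁻¹ + M)⁻¹ * D⁻¹) +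
        G * (D * M * ((D⁻¹ + M)⁻¹ * D⁻¹)) := by
        rw [Matrix.mul_assoc _ _ F, hpush, Matrix.add_mul, Matrix.mul_assoc (G * D), hFt, hM]
        simp only [Matrix.add_mul, Matrix.mul_assoc]
    _ = _ := by
        rw [hDM', Matrix.mul_sub, Matrix.mul_one, Matrix.mul_assoc _ _ D⁻¹, Matrix.sub_mul]
        abel

/-- Cancellation of the prior input mean in the limit: K(D_k) C G → G. -/
theorem sise_prior_mean_cancellation
    (n m p : ℕ) (hn : 0 < n) (hm : 0 < m) (hp : 0 < p)
    (C : Matrix (Fin p) (Fin n) ℝ) (G : Matrix (Fin n) (Fin m) ℝ)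
    (R : Matrix (Fin p) (Fin p) ℝ) (hR : R.PosDef)
    (X : Matrix (Fin n) (Fin n) ℝ) (hX : X.PosSemidef)
    (S : Matrix (Fin p) (Fin p) ℝ) (hS : S = R + C * X * Cᵀ)
    (hrank : (C * G).rank = m)
    (D : ℕ → Matrix (Fin m) (Fin m) ℝ) (hD : ∀ k, (D k).PosDef)
    (hDinv : Tendsto (fun k => (D k)⁻¹) atTop (nhds 0)) :
    Tendsto
      (fun k => ((X + G * D k * Gᵀ) * Cᵀ * (S + C * G * D k * Gᵀ * Cᵀ)⁻¹) * (C * G))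
      atTop (nhds G) := by
  have hSpd : S.PosDef := by
    rw [hS, ← conjTranspose_eq_transpose_of_trivial]
    exact hR.add_posSemidef (hX.mul_mul_conjTranspose_same C)
  have hM : ((C * G)ᵀ * S⁻¹ * (C * G)).PosDef := by
    rw [← conjTranspose_eq_transpose_of_trivial]
    exact hSpd.inv.conjTranspose_mul_mul_same (mulVec_injective_of_rank_eq hrank)
  have hW (k : ℕ) : (S + C * G * D k * Gᵀ * Cᵀ).PosDef := by
    rw [Matrix.mul_assoc _ Gᵀ, ← transpose_mul, ← conjTranspose_eq_transpose_of_trivial]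
    exact hSpd.add_posSemidef ((hD k).posSemidef.mul_mul_conjTranspose_same (C * G))
  have hE (k : ℕ) := (hD k).inv.add hM
  simp_rw [fun k => gain_mul_eq C G X S (D k) hSpd.det_pos.ne'.isUnit
    (hD k).det_pos.ne'.isUnit (hW k).det_pos.ne'.isUnit (hE k).det_pos.ne'.isUnit]
  have hsum : Tendsto (fun k => (D k)⁻¹ + (C * G)ᵀ * S⁻¹ * (C * G)) atTop
      (nhds ((C * G)ᵀ * S⁻¹ * (C * G))) := by
    simpa using hDinv.add_const ((C * G)ᵀ * S⁻¹ * (C * G))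
  have hinv : Tendsto (fun k => ((D k)⁻¹ + (C * G)ᵀ * S⁻¹ * (C * G))⁻¹) atTop
      (nhds ((C * G)ᵀ * S⁻¹ * (C * G))⁻¹) := by
    refine (continuousAt_matrix_inv _ ?_).tendsto.comp hsum
    rw [Ring.inverse_eq_inv']
    exact continuousAt_inv₀ hM.det_pos.ne'
  have hcont : Continuous fun Y : Matrix (Fin m) (Fin m) ℝ × Matrix (Fin m) (Fin m) ℝ =>
      G + (X * Cᵀ * S⁻¹ * (C * G) - G) * Y.1 * Y.2 := by fun_prop
  simpa [Function.comp_def] using (hcont.tendsto _).comp (hinv.prodMk_nhds hDinv)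
end

section
/- Determinant identity for the weight recursion: for every symmetric positive definite matrix D ∈ ℝ^{m×m}, det(I_p − C G L(D)) · det(D) · det(D⁻¹ + 𝒯) = 1. -/
open Matrix

/-- If `S`, `D` and `M = S + H * D * V` are invertible, then the determinant of the complementary
gain `1 - H * D * V * M⁻¹` is inverse to `det D * det (D⁻¹ + V * S⁻¹ * H)`. -/
lemma det_one_sub_gain_mul {ι κ 𝕜 : Type*} [Fintype ι] [DecidableEq ι] [Fintype κ]
    [DecidableEq κ] [Field 𝕜] (S : Matrix ι ι 𝕜) (D : Matrix κ κ 𝕜) (H : Matrix ι κ 𝕜)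
    (V : Matrix κ ι 𝕜) (hS : IsUnit S.det) (hD : IsUnit D.det)
    (hM : IsUnit (S + H * D * V).det) :
    (1 - H * D * V * (S + H * D * V)⁻¹).det * D.det * (D⁻¹ + V * S⁻¹ * H).det = 1 := by
  have hgain : 1 - H * D * V * (S + H * D * V)⁻¹ = S * (S + H * D * V)⁻¹ := by
    rw [sub_eq_iff_eq_add, ← add_mul, mul_nonsing_inv _ hM]
  have hdet : (S + H * D * V).det = S.det * ((D⁻¹ + V * S⁻¹ * H).det * D.det) := by
    rw [det_add_mul _ _ hS, ← det_mul, add_mul, nonsing_inv_mul _ hD]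
    simp only [Matrix.mul_assoc]
  calc (1 - H * D * V * (S + H * D * V)⁻¹).det * D.det * (D⁻¹ + V * S⁻¹ * H).det
      = S.det * ((D⁻¹ + V * S⁻¹ * H).det * D.det) * (S + H * D * V)⁻¹.det := by
        rw [hgain, det_mul]; ring
    _ = 1 := by rw [← hdet, ← det_mul, mul_nonsing_inv _ hM, det_one]

/-- Determinant identity for the weight recursion. -/
theorem sise_weight_det_identity
    (n m p : ℕ) (hn : 0 < n) (hm : 0 < m) (hp : 0 < p)
    (C : Matrix (Fin p) (Fin n) ℝ) (G : Matrix (Fin n) (Fin m) ℝ)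
    (R : Matrix (Fin p) (Fin p) ℝ) (hR : R.PosDef)
    (X : Matrix (Fin n) (Fin n) ℝ) (hX : X.PosSemidef)
    (S : Matrix (Fin p) (Fin p) ℝ) (hS : S = R + C * X * Cᵀ)
    (T : Matrix (Fin m) (Fin m) ℝ) (hT : T = Gᵀ * Cᵀ * S⁻¹ * C * G)
    (hrank : (C * G).rank = m)
    (D : Matrix (Fin m) (Fin m) ℝ) (hD : D.PosDef)
    (L : Matrix (Fin m) (Fin p) ℝ)
    (hL : L = D * Gᵀ * Cᵀ * (S + C * G * D * Gᵀ * Cᵀ)⁻¹) :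
    (1 - C * G * L).det * D.det * (D⁻¹ + T).det = 1 := by
  have hSpos : S.PosDef := by
    rw [hS]
    exact hR.add_posSemidef (by simpa using hX.mul_mul_conjTranspose_same C)
  have hMpos : (S + C * G * D * (Gᵀ * Cᵀ)).PosDef :=
    hSpos.add_posSemidef (by simpa using hD.posSemidef.mul_mul_conjTranspose_same (C * G))
  have h := det_one_sub_gain_mul S D (C * G) (Gᵀ * Cᵀ) hSpos.det_pos.ne'.isUnit
    hD.det_pos.ne'.isUnit hMpos.det_pos.ne'.isUnit
  rw [hL, hT]
  simpa only [Matrix.mul_assoc] using h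
end

section
/- Gaussian measurement-update product identity: let R ∈ ℝ^{p×p} and Σ ∈ ℝ^{n×n} be symmetric positive definite, C ∈ ℝ^{p×n}, μ ∈ ℝ^p, x̂ ∈ ℝ^n, and define K = Σ Cᵀ (R + C Σ Cᵀ)⁻¹. Then (I_n − K C) Σ is symmetric positive definite, and for all x ∈ ℝ^n and z ∈ ℝ^p, N_p(z; C x + μ, R) · N_n(x; x̂, Σ) = N_p(z; C x̂ + μ, R + C Σ Cᵀ) · N_n(x; x̂ + K (z − C x̂ − μ), (I_n − K C) Σ). -/
open Matrix Real

/-- The Gaussian probability density on ℝ^ι with mean `μ` and covariance `Σ`,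
evaluated at `x`. -/
noncomputable def gaussianPDF {ι : Type*} [Fintype ι] [DecidableEq ι]
    (x μ : ι → ℝ) (S : Matrix ι ι ℝ) : ℝ :=
  (2 * Real.pi) ^ (-(Fintype.card ι : ℝ) / 2) * S.det ^ (-(1 : ℝ) / 2) *
    Real.exp (-(1 / 2) * ((x - μ) ⬝ᵥ S⁻¹ *ᵥ (x - μ)))

theorem dotProduct_mulVec_eq_transpose_mulVec_dotProduct {m k : Type*} [Fintype m] [Fintype k]
    (A : Matrix m k ℝ) (u : m → ℝ) (v : k → ℝ) : u ⬝ᵥ A *ᵥ v = Aᵀ *ᵥ u ⬝ᵥ v := by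
  rw [dotProduct_mulVec, mulVec_transpose]

theorem posDef_innovation {m k : Type*} [Fintype m] [Fintype k] {R : Matrix m m ℝ}
    {S : Matrix k k ℝ} (C : Matrix m k ℝ) (hR : R.PosDef) (hS : S.PosDef) :
    (R + C * S * Cᵀ).PosDef := by
  have h := hS.posSemidef.mul_mul_conjTranspose_same C
  rw [conjTranspose_eq_transpose_of_trivial] at h
  exact hR.add_posSemidef h

section MeasurementUpdate

variable {m k : Type*} [Fintype m] [DecidableEq m] [Fintype k] [DecidableEq k]
  {R : Matrix m m ℝ} {S : Matrix k k ℝ} (C : Matrix m k ℝ)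

theorem posDef_information (hR : R.PosDef) (hS : S.PosDef) : (S⁻¹ + Cᵀ * R⁻¹ * C).PosDef := by
  have h := hR.inv.posSemidef.conjTranspose_mul_mul_same C
  rw [conjTranspose_eq_transpose_of_trivial] at h
  exact hS.inv.add_posSemidef h

/-- The updated covariance is the inverse of the information matrix. -/
theorem updated_covariance_mul_information (hR : R.PosDef) (hS : S.PosDef) :
    (1 - S * Cᵀ * (R + C * S * Cᵀ)⁻¹ * C) * S * (S⁻¹ + Cᵀ * R⁻¹ * C) = 1 := by
  have hT := (posDef_innovation C hR hS).isUnit.map detMonoidHom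
  have hRu := hR.isUnit.map detMonoidHom
  have hSu := hS.isUnit.map detMonoidHom
  have hC : C * (S * (S⁻¹ + Cᵀ * R⁻¹ * C)) = (R + C * S * Cᵀ) * (R⁻¹ * C) := by
    rw [Matrix.mul_add S, mul_nonsing_inv _ hSu, Matrix.add_mul, mul_nonsing_inv_cancel_left _ _ hRu]
    simp only [Matrix.mul_add, Matrix.mul_one, Matrix.mul_assoc]
  rw [Matrix.mul_assoc, Matrix.sub_mul, Matrix.one_mul, Matrix.mul_assoc _ C, hC,
    Matrix.mul_assoc (S * Cᵀ), nonsing_inv_mul_cancel_left _ _ hT, Matrix.mul_add,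
    mul_nonsing_inv _ hSu]
  simp only [Matrix.mul_assoc, add_sub_cancel_right]

theorem inv_updated_covariance (hR : R.PosDef) (hS : S.PosDef) :
    ((1 - S * Cᵀ * (R + C * S * Cᵀ)⁻¹ * C) * S)⁻¹ = S⁻¹ + Cᵀ * R⁻¹ * C :=
  inv_eq_right_inv (updated_covariance_mul_information C hR hS)

theorem posDef_updated_covariance (hR : R.PosDef) (hS : S.PosDef) :
    ((1 - S * Cᵀ * (R + C * S * Cᵀ)⁻¹ * C) * S).PosDef := by
  rw [← posDef_inv_iff, inv_updated_covariance C hR hS]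
  exact posDef_information C hR hS

theorem det_innovation_mul_det_updated_covariance (hR : R.PosDef) (hS : S.PosDef) :
    (R + C * S * Cᵀ).det * ((1 - S * Cᵀ * (R + C * S * Cᵀ)⁻¹ * C) * S).det = R.det * S.det := by
  have hT := (posDef_innovation C hR hS).isUnit.map detMonoidHom
  have h : (1 - C * (S * Cᵀ * (R + C * S * Cᵀ)⁻¹)) * (R + C * S * Cᵀ) = R := by
    rw [Matrix.sub_mul, Matrix.one_mul, ← Matrix.mul_assoc C, nonsing_inv_mul_cancel_right _ _ hT,
      Matrix.mul_assoc C, add_sub_cancel_right]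
  rw [det_mul, det_one_sub_mul_comm, ← mul_assoc, mul_comm (det _), ← det_mul, h]

/-- Completing the square in the sum of the measurement and prior quadratic forms. -/
theorem quadratic_form_complete_square (hR : R.PosDef) (hS : S.PosDef) (s : m → ℝ) (w : k → ℝ) :
    (R *ᵥ s - C *ᵥ w) ⬝ᵥ R⁻¹ *ᵥ (R *ᵥ s - C *ᵥ w) +
        (w + (S * Cᵀ) *ᵥ s) ⬝ᵥ S⁻¹ *ᵥ (w + (S * Cᵀ) *ᵥ s) =
      (R + C * S * Cᵀ) *ᵥ s ⬝ᵥ s + w ⬝ᵥ (S⁻¹ + Cᵀ * R⁻¹ * C) *ᵥ w := by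
  have hRu := hR.isUnit.map detMonoidHom
  have hSu := hS.isUnit.map detMonoidHom
  have hRt : Rᵀ = R := hR.isHermitian
  have hSt : Sᵀ = S := hS.isHermitian
  have e1 : R⁻¹ *ᵥ (R *ᵥ s) = s := by rw [mulVec_mulVec, nonsing_inv_mul _ hRu, one_mulVec]
  have e2 : S⁻¹ *ᵥ ((S * Cᵀ) *ᵥ s) = Cᵀ *ᵥ s := by
    rw [mulVec_mulVec, nonsing_inv_mul_cancel_left _ _ hSu]
  have e3 : R *ᵥ s ⬝ᵥ R⁻¹ *ᵥ (C *ᵥ w) = C *ᵥ w ⬝ᵥ s := by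
    rw [dotProduct_mulVec_eq_transpose_mulVec_dotProduct, transpose_nonsing_inv, hRt, e1, dotProduct_comm]
  have e4 : (S * Cᵀ) *ᵥ s ⬝ᵥ S⁻¹ *ᵥ w = C *ᵥ w ⬝ᵥ s := by
    rw [dotProduct_mulVec_eq_transpose_mulVec_dotProduct, transpose_nonsing_inv, hSt, e2,
      ← dotProduct_mulVec_eq_transpose_mulVec_dotProduct, dotProduct_comm]
  have e5 : w ⬝ᵥ Cᵀ *ᵥ s = C *ᵥ w ⬝ᵥ s := by
    rw [dotProduct_mulVec_eq_transpose_mulVec_dotProduct, transpose_transpose]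
  have e6 : (S * Cᵀ) *ᵥ s ⬝ᵥ Cᵀ *ᵥ s = (C * S * Cᵀ) *ᵥ s ⬝ᵥ s := by
    rw [dotProduct_mulVec_eq_transpose_mulVec_dotProduct, transpose_transpose, mulVec_mulVec,
      Matrix.mul_assoc]
  have e7 : w ⬝ᵥ (Cᵀ * R⁻¹ * C) *ᵥ w = C *ᵥ w ⬝ᵥ R⁻¹ *ᵥ (C *ᵥ w) := by
    rw [Matrix.mul_assoc, ← mulVec_mulVec, dotProduct_mulVec_eq_transpose_mulVec_dotProduct,
      transpose_transpose, mulVec_mulVec]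
  simp only [mulVec_sub, mulVec_add, add_mulVec, dotProduct_sub, sub_dotProduct, dotProduct_add,
    add_dotProduct, e1, e2, e3, e4, e5, e6, e7]
  ring

end MeasurementUpdate

/-- Gaussian measurement-update product identity. -/
theorem gaussian_measurement_update_product
    (n p : ℕ) (hn : 0 < n) (hp : 0 < p)
    (R : Matrix (Fin p) (Fin p) ℝ) (hR : R.PosDef)
    (Sig : Matrix (Fin n) (Fin n) ℝ) (hSig : Sig.PosDef)
    (C : Matrix (Fin p) (Fin n) ℝ) (μ : Fin p → ℝ) (xhat : Fin n → ℝ)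
    (K : Matrix (Fin n) (Fin p) ℝ)
    (hK : K = Sig * Cᵀ * (R + C * Sig * Cᵀ)⁻¹) :
    ((1 - K * C) * Sig).PosDef ∧
      ∀ (x : Fin n → ℝ) (z : Fin p → ℝ),
        gaussianPDF z (C *ᵥ x + μ) R * gaussianPDF x xhat Sig =
          gaussianPDF z (C *ᵥ xhat + μ) (R + C * Sig * Cᵀ) *
            gaussianPDF x (xhat + K *ᵥ (z - C *ᵥ xhat - μ)) ((1 - K * C) * Sig) := by
  subst hK
  refine ⟨posDef_updated_covariance C hR hSig, fun x z ↦ ?_⟩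
  have hT := posDef_innovation C hR hSig
  have hP := posDef_updated_covariance C hR hSig
  have hdet := det_innovation_mul_det_updated_covariance C hR hSig
  have hinv := inv_updated_covariance C hR hSig
  have hsq := quadratic_form_complete_square C hR hSig
  set T := R + C * Sig * Cᵀ with hTdef
  set e := z - C *ᵥ xhat - μ with he
  set P := (1 - Sig * Cᵀ * T⁻¹ * C) * Sig
  set s := T⁻¹ *ᵥ e with hs
  set w := x - (xhat + (Sig * Cᵀ * T⁻¹) *ᵥ e) with hw
  have hx : x - xhat = w + (Sig * Cᵀ) *ᵥ s := by
    rw [hw, hs, mulVec_mulVec]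
    abel
  have hTs : T *ᵥ s = e := by
    rw [hs, mulVec_mulVec, mul_nonsing_inv _ (hT.isUnit.map detMonoidHom), one_mulVec]
  have hz : z - (C *ᵥ x + μ) = R *ᵥ s - C *ᵥ w := by
    have h1 : R *ᵥ s = e - C *ᵥ ((Sig * Cᵀ) *ᵥ s) := by
      rw [← hTs, hTdef, add_mulVec, mulVec_mulVec s C, Matrix.mul_assoc, add_sub_cancel_right]
    have h2 : C *ᵥ x = C *ᵥ xhat + C *ᵥ w + C *ᵥ ((Sig * Cᵀ) *ᵥ s) := by
      rw [← mulVec_add, ← mulVec_add, add_assoc, ← hx, add_sub_cancel]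
    rw [h1, h2, he]
    abel
  have hquad := hsq s w
  rw [← hz, ← hx, hTs, ← hinv, hs] at hquad
  have hze : z - (C *ᵥ xhat + μ) = e := by rw [he, sub_sub]
  have hdet' : T.det ^ (-(1 : ℝ) / 2) * P.det ^ (-(1 : ℝ) / 2) =
      R.det ^ (-(1 : ℝ) / 2) * Sig.det ^ (-(1 : ℝ) / 2) := by
    rw [← Real.mul_rpow hT.det_pos.le hP.det_pos.le, hdet,
      Real.mul_rpow hR.det_pos.le hSig.det_pos.le]
  unfold gaussianPDF
  rw [hze, ← hw, mul_mul_mul_comm, ← Real.exp_add, ← mul_add, hquad, mul_mul_mul_comm, ← hdet',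
    mul_mul_mul_comm _ (Real.exp _), ← Real.exp_add, ← mul_add, mul_mul_mul_comm _ (T.det ^ _)]
end

section
/- Input measurement-update identity: let R ∈ ℝ^{p×p}, X ∈ ℝ^{n×n}, and D ∈ ℝ^{m×m} be symmetric positive definite, C ∈ ℝ^{p×n}, G ∈ ℝ^{n×m}, μ ∈ ℝ^p, m₀ ∈ ℝ^n, 𝔡 ∈ ℝ^m. Set Σ = X + G D Gᵀ and let Π ∈ ℝ^{(n+m)×(n+m)} be the block matrix with blocks Π₁₁ = Σ, Π₁₂ = G D, Π₂₁ = D Gᵀ, Π₂₂ = D (Π is symmetric positive definite). Define L = D Gᵀ Cᵀ (R + C Σ Cᵀ)⁻¹. Then (I_m − L C G) D is symmetric positive definite, and for every ζ ∈ ℝ^p and d ∈ ℝ^m, ∫_{ℝ^n} N_p(ζ; C x + μ, R) · N_{n+m}((x, d); (m₀, 𝔡), Π) dx = N_p(ζ; C m₀ + μ, R + C Σ Cᵀ) · N_m(d; 𝔡 + L (ζ − C m₀ − μ), (I_m − L C G) D). -/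
open Matrix Real MeasureTheory

/-- The standard Gaussian integral on `ι → ℝ`. -/
theorem integral_exp_neg_half_dotProduct_self (ι : Type*) [Fintype ι] :
    ∫ x : ι → ℝ, Real.exp (-(1 / 2) * (x ⬝ᵥ x)) = (2 * π) ^ ((Fintype.card ι : ℝ) / 2) := by
  have h (x : ι → ℝ) :
      Real.exp (-(1 / 2) * (x ⬝ᵥ x)) = ∏ i, Real.exp (-(1 / 2) * x i ^ 2) := by
    rw [← Real.exp_sum, ← Finset.mul_sum]
    simp only [dotProduct, pow_two]
  simp_rw [h]
  rw [integral_fintype_prod_volume_eq_pow (fun y : ℝ => Real.exp (-(1 / 2) * y ^ 2)),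
    integral_gaussian, Real.sqrt_eq_rpow, ← Real.rpow_natCast, ← Real.rpow_mul (by positivity)]
  congr 1 <;> ring

open scoped MatrixOrder in
/-- A Gaussian density with positive definite covariance integrates to one. -/
theorem integral_gaussianPDF {ι : Type*} [Fintype ι] [DecidableEq ι]
    (μ : ι → ℝ) {S : Matrix ι ι ℝ} (hS : S.PosDef) : ∫ x, gaussianPDF x μ S = 1 := by
  obtain ⟨M, hM⟩ := CStarAlgebra.nonneg_iff_eq_star_mul_self.mp hS.inv.posSemidef.nonneg
  rw [star_eq_conjTranspose, conjTranspose_eq_transpose_of_trivial] at hM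
  have hdet : S.det⁻¹ = M.det ^ 2 := by
    rw [← Ring.inverse_eq_inv', ← det_nonsing_inv, hM, det_mul, det_transpose, pow_two]
  have hSd := hS.det_pos
  have hMd : M.det ≠ 0 := by
    intro h0
    rw [h0] at hdet
    simp at hdet
    exact hSd.ne' hdet
  have habs : |M.det| = S.det ^ (-(1 : ℝ) / 2) := by
    rw [neg_div, Real.rpow_neg hSd.le, ← Real.inv_rpow hSd.le, hdet, ← Real.sqrt_eq_rpow,
      Real.sqrt_sq_eq_abs]
  have hquad (x : ι → ℝ) : x ⬝ᵥ S⁻¹ *ᵥ x = toLin' M x ⬝ᵥ toLin' M x := by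
    rw [hM, ← mulVec_mulVec, dotProduct_mulVec, vecMul_transpose, toLin'_apply]
  have hcv : ∫ x : ι → ℝ, Real.exp (-(1 / 2) * (toLin' M x ⬝ᵥ toLin' M x)) =
      |M.det|⁻¹ * ∫ x : ι → ℝ, Real.exp (-(1 / 2) * (x ⬝ᵥ x)) := by
    have hc : Continuous (toLin' M) := (toLin' M).continuous_of_finiteDimensional
    have hf : Continuous fun x : ι → ℝ => Real.exp (-(1 / 2) * (x ⬝ᵥ x)) := by
      unfold dotProduct
      fun_prop
    have h := integral_map (μ := volume) hc.measurable.aemeasurable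
      (f := fun x : ι → ℝ => Real.exp (-(1 / 2) * (x ⬝ᵥ x))) hf.aestronglyMeasurable
    rw [← h, Real.map_matrix_volume_pi_eq_smul_volume_pi hMd, integral_smul_measure,
      ENNReal.toReal_ofReal (abs_nonneg _), abs_inv, smul_eq_mul]
  simp only [gaussianPDF, integral_const_mul]
  rw [integral_sub_right_eq_self
    (fun x : ι → ℝ => Real.exp (-(1 / 2) * (x ⬝ᵥ S⁻¹ *ᵥ x))) μ]
  simp_rw [hquad]
  rw [hcv, integral_exp_neg_half_dotProduct_self, ← habs, neg_div, Real.rpow_neg (by positivity)]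
  have : (0 : ℝ) < (2 * π) ^ ((Fintype.card ι : ℝ) / 2) := by positivity
  have := abs_pos.mpr hMd
  field_simp

/-- Relabelling the coordinates does not change a Gaussian density. -/
theorem gaussianPDF_comp_equiv {ι κ : Type*} [Fintype ι] [DecidableEq ι] [Fintype κ]
    [DecidableEq κ] (e : κ ≃ ι) (x μ : ι → ℝ) (S : Matrix ι ι ℝ) :
    gaussianPDF (x ∘ e) (μ ∘ e) (S.submatrix e e) = gaussianPDF x μ S := by
  have h : x ∘ e - μ ∘ e = (x - μ) ∘ e := rfl
  simp only [gaussianPDF, det_submatrix_equiv_self, inv_submatrix_equiv, h,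
    submatrix_mulVec_equiv, Fintype.card_congr e]
  congr 3
  simp [Function.comp_assoc]

/-- The covariance of the innovation is positive definite. -/
theorem posDef_add_mul_mul_transpose {ι κ : Type*} [Fintype ι] [Fintype κ]
    {T : Matrix κ κ ℝ} (hT : T.PosDef) {D : Matrix ι ι ℝ}
    (hD : D.PosDef) (H : Matrix κ ι ℝ) :
    (T + H * D * Hᵀ).PosDef :=
  hT.add_posSemidef <| by
    simpa using hD.posSemidef.mul_mul_conjTranspose_same H

section Blocks

variable {ι κ : Type*} [Fintype ι] [DecidableEq ι] [Fintype κ] [DecidableEq κ]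

/-- The determinant of the joint covariance of `u` and `H u + v`, for independent `u` and `v`
with covariances `D` and `T`. -/
theorem det_fromBlocks_regression (T : Matrix κ κ ℝ) {D : Matrix ι ι ℝ} (hD : IsUnit D)
    (H : Matrix κ ι ℝ) :
    (fromBlocks (T + H * D * Hᵀ) (H * D) (D * Hᵀ) D).det = T.det * D.det := by
  let := hD.invertible
  rw [det_fromBlocks₂₂, mul_comm]
  congr 2
  simp [Matrix.mul_assoc]

/-- Factorization of a joint Gaussian density in linear regression form. -/
theorem gaussianPDF_fromBlocks_regression {T : Matrix κ κ ℝ} (hT : T.PosDef)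
    {D : Matrix ι ι ℝ} (hD : D.PosDef) (H : Matrix κ ι ℝ) (z a : κ → ℝ) (u b : ι → ℝ) :
    gaussianPDF (Sum.elim z u) (Sum.elim a b)
        (fromBlocks (T + H * D * Hᵀ) (H * D) (D * Hᵀ) D) =
      gaussianPDF z (a + H *ᵥ (u - b)) T * gaussianPDF u b D := by
  have hdet := det_fromBlocks_regression T hD.isUnit H
  set J := fromBlocks (T + H * D * Hᵀ) (H * D) (D * Hᵀ) D with hJ
  have hTu : IsUnit T.det := hT.det_pos.ne'.isUnit
  have hDu : IsUnit D.det := hD.det_pos.ne'.isUnit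
  have hJu : IsUnit J.det := hdet ▸ hTu.mul hDu
  set v := u - b with hv
  set r := z - (a + H *ᵥ v) with hr
  have hsub : Sum.elim z u - Sum.elim a b = Sum.elim (z - a) v := by
    ext (i | i) <;> rfl
  have hz : z - a = r + H *ᵥ v := by rw [hr]; abel
  have hsol : J *ᵥ Sum.elim (T⁻¹ *ᵥ r) (D⁻¹ *ᵥ v - Hᵀ *ᵥ (T⁻¹ *ᵥ r)) = Sum.elim (z - a) v := by
    rw [hJ, fromBlocks_mulVec, hz]
    simp only [Sum.elim_comp_inl, Sum.elim_comp_inr, mulVec_sub, mulVec_mulVec, Matrix.add_mul,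
      Matrix.mul_assoc, mul_nonsing_inv _ hTu, mul_nonsing_inv _ hDu, one_mulVec, Matrix.mul_one,
      add_mulVec]
    congr 1 <;> abel
  have hinv : J⁻¹ *ᵥ Sum.elim (z - a) v =
      Sum.elim (T⁻¹ *ᵥ r) (D⁻¹ *ᵥ v - Hᵀ *ᵥ (T⁻¹ *ᵥ r)) := by
    rw [← hsol, mulVec_mulVec, nonsing_inv_mul _ hJu, one_mulVec]
  have hquad : Sum.elim (z - a) v ⬝ᵥ J⁻¹ *ᵥ Sum.elim (z - a) v =
      r ⬝ᵥ T⁻¹ *ᵥ r + v ⬝ᵥ D⁻¹ *ᵥ v := by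
    rw [hinv, sumElim_dotProduct_sumElim, hz, add_dotProduct, dotProduct_sub,
      dotProduct_mulVec v Hᵀ, vecMul_transpose]
    ring
  simp only [gaussianPDF, hsub, hquad, hdet, Fintype.card_sum, Nat.cast_add]
  rw [Real.mul_rpow hT.det_pos.le hD.det_pos.le, mul_add, Real.exp_add, neg_add, add_div,
    Real.rpow_add (by positivity)]
  ring

/-- The posterior covariance in a linear Gaussian model is positive definite. -/
theorem posDef_posterior {T : Matrix κ κ ℝ} (hT : T.PosDef) {D : Matrix ι ι ℝ}
    (hD : D.PosDef) (H : Matrix κ ι ℝ) :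
    ((1 - D * Hᵀ * (T + H * D * Hᵀ)⁻¹ * H) * D).PosDef := by
  have hS := posDef_add_mul_mul_transpose hT hD H
  have hDt : Dᵀ = D := by simpa using hD.isHermitian.eq
  let := hS.isUnit.invertible
  let := hD.isUnit.invertible
  have hdet := det_fromBlocks_regression T hD.isUnit H
  have hJ : (fromBlocks (T + H * D * Hᵀ) (H * D) (H * D)ᴴ D).PosSemidef := by
    rw [PosDef.fromBlocks₂₂ _ _ hD]
    have hschur : T + H * D * Hᵀ - H * D * D⁻¹ * (H * D)ᴴ = T := by
      simp [Matrix.mul_assoc, hDt]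
    rw [hschur]
    exact hT.posSemidef
  rw [PosDef.fromBlocks₁₁ _ _ hS] at hJ
  have heq : D - (H * D)ᴴ * (T + H * D * Hᵀ)⁻¹ * (H * D) =
      (1 - D * Hᵀ * (T + H * D * Hᵀ)⁻¹ * H) * D := by
    simp [Matrix.sub_mul, Matrix.mul_assoc, hDt]
  rw [heq] at hJ
  rw [hJ.posDef_iff_isUnit, isUnit_iff_isUnit_det, isUnit_iff_ne_zero]
  intro h0
  rw [det_fromBlocks₁₁, invOf_eq_nonsing_inv] at hdet
  have : D - D * Hᵀ * (T + H * D * Hᵀ)⁻¹ * (H * D) =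
      (1 - D * Hᵀ * (T + H * D * Hᵀ)⁻¹ * H) * D := by
    simp [Matrix.sub_mul, Matrix.mul_assoc]
  rw [this, h0, mul_zero] at hdet
  exact (mul_pos hT.det_pos hD.det_pos).ne hdet

/-- Bayes' rule for a linear Gaussian model. -/
theorem gaussianPDF_mul_gaussianPDF_eq_posterior {T : Matrix κ κ ℝ} (hT : T.PosDef)
    {D : Matrix ι ι ℝ} (hD : D.PosDef) (H : Matrix κ ι ℝ) (z a : κ → ℝ) (u b : ι → ℝ) :
    gaussianPDF z (a + H *ᵥ (u - b)) T * gaussianPDF u b D =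
      gaussianPDF z a (T + H * D * Hᵀ) *
        gaussianPDF u (b + (D * Hᵀ * (T + H * D * Hᵀ)⁻¹) *ᵥ (z - a))
          ((1 - D * Hᵀ * (T + H * D * Hᵀ)⁻¹ * H) * D) := by
  have hS := posDef_add_mul_mul_transpose hT hD H
  have hP := posDef_posterior hT hD H
  have hDt : Dᵀ = D := by simpa using hD.isHermitian.eq
  rw [← gaussianPDF_fromBlocks_regression hT hD]
  set S := T + H * D * Hᵀ
  have hSt : Sᵀ = S := by simpa using hS.isHermitian.eq
  have hSu : IsUnit S.det := hS.det_pos.ne'.isUnit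
  set K := D * Hᵀ * S⁻¹ with hK
  have hKS : K * S = D * Hᵀ := by rw [hK, nonsing_inv_mul_cancel_right _ _ hSu]
  have hSK : S * Kᵀ = H * D := by
    rw [← transpose_inj, transpose_mul, transpose_transpose, hSt, hKS, transpose_mul, hDt]
  have hDD : (1 - K * H) * D + K * S * Kᵀ = D := by
    rw [Matrix.mul_assoc K, hSK, Matrix.sub_mul, Matrix.mul_assoc, Matrix.one_mul,
      sub_add_cancel]
  rw [mul_comm, ← gaussianPDF_fromBlocks_regression hP hS, hDD, hKS, hSK,
    ← gaussianPDF_comp_equiv (Equiv.sumComm ι κ)]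
  congr 1
  · ext (i | i) <;> rfl
  · ext (i | i) <;> rfl
  · exact fromBlocks_submatrix_sum_swap_sum_swap _ _ _ _

/-- The marginal density of the observation in a linear Gaussian model. -/
theorem integral_gaussianPDF_mul_gaussianPDF {T : Matrix κ κ ℝ} (hT : T.PosDef)
    {D : Matrix ι ι ℝ} (hD : D.PosDef) (H : Matrix κ ι ℝ) (z a : κ → ℝ) (b : ι → ℝ) :
    ∫ u, gaussianPDF z (a + H *ᵥ (u - b)) T * gaussianPDF u b D =
      gaussianPDF z a (T + H * D * Hᵀ) := by
  simp_rw [gaussianPDF_mul_gaussianPDF_eq_posterior hT hD H]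
  rw [integral_const_mul, integral_gaussianPDF _ (posDef_posterior hT hD H), mul_one]

end Blocks

/-- Input measurement-update identity. -/
theorem gaussian_input_measurement_update
    (n m p : ℕ) (hn : 0 < n) (hm : 0 < m) (hp : 0 < p)
    (R : Matrix (Fin p) (Fin p) ℝ) (hR : R.PosDef)
    (X : Matrix (Fin n) (Fin n) ℝ) (hX : X.PosDef)
    (D : Matrix (Fin m) (Fin m) ℝ) (hD : D.PosDef)
    (C : Matrix (Fin p) (Fin n) ℝ) (G : Matrix (Fin n) (Fin m) ℝ)
    (μ : Fin p → ℝ) (m₀ : Fin n → ℝ) (dbar : Fin m → ℝ)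
    (Sig : Matrix (Fin n) (Fin n) ℝ) (hSig : Sig = X + G * D * Gᵀ)
    (Pi : Matrix (Fin n ⊕ Fin m) (Fin n ⊕ Fin m) ℝ)
    (hPi : Pi = Matrix.fromBlocks Sig (G * D) (D * Gᵀ) D)
    (hPipos : Pi.PosDef)
    (L : Matrix (Fin m) (Fin p) ℝ)
    (hL : L = D * Gᵀ * Cᵀ * (R + C * Sig * Cᵀ)⁻¹) :
    ((1 - L * (C * G)) * D).PosDef ∧
      ∀ (ζ : Fin p → ℝ) (d : Fin m → ℝ),
        (∫ x : Fin n → ℝ,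
            gaussianPDF ζ (C *ᵥ x + μ) R *
              gaussianPDF (Sum.elim x d) (Sum.elim m₀ dbar) Pi) =
          gaussianPDF ζ (C *ᵥ m₀ + μ) (R + C * Sig * Cᵀ) *
            gaussianPDF d (dbar + L *ᵥ (ζ - C *ᵥ m₀ - μ)) ((1 - L * (C * G)) * D) := by
  have hS : R + C * Sig * Cᵀ = R + C * X * Cᵀ + C * G * D * (C * G)ᵀ := by
    simp only [hSig, Matrix.mul_add, Matrix.add_mul, transpose_mul, Matrix.mul_assoc, add_assoc]
  have hL' : L = D * (C * G)ᵀ * (R + C * X * Cᵀ + C * G * D * (C * G)ᵀ)⁻¹ := by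
    rw [hL, hS, transpose_mul, Matrix.mul_assoc D]
  rw [hS, hL', hPi, hSig]
  refine ⟨posDef_posterior (posDef_add_mul_mul_transpose hR hX C) hD (C * G), fun ζ d => ?_⟩
  simp_rw [gaussianPDF_fromBlocks_regression hX hD]
  set b := m₀ + G *ᵥ (d - dbar) with hb
  have hmean (x : Fin n → ℝ) :
      C *ᵥ x + μ = (C *ᵥ m₀ + μ) + (C * G) *ᵥ (d - dbar) + C *ᵥ (x - b) := by
    rw [mulVec_sub C, hb, mulVec_add, mulVec_mulVec]; abel
  simp_rw [← mul_assoc]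
  rw [integral_mul_const]
  have hint (x : Fin n → ℝ) := congrArg (gaussianPDF ζ · R) (hmean x)
  simp only [hint]
  rw [integral_gaussianPDF_mul_gaussianPDF hR hX,
    gaussianPDF_mul_gaussianPDF_eq_posterior (posDef_add_mul_mul_transpose hR hX C) hD,
    sub_sub]
end

section
/- Gaussian-mixture measurement update (measurement-update step of the Gaussian sum filter): let R ∈ ℝ^{p×p} be symmetric positive definite and C ∈ ℝ^{p×n}. Let K₀ and M be positive integers; for κ = 1,…,K₀ let φ^κ > 0, μ^κ ∈ ℝ^p, ζ^κ ∈ ℝ^p, and for ℓ = 1,…,M let δ^ℓ > 0, x̂^ℓ ∈ ℝ^n, and Σ^ℓ ∈ ℝ^{n×n} symmetric positive definite. Define, for each pair (κ, ℓ): K^ℓ = Σ^ℓ Cᵀ (R + C Σ^ℓ Cᵀ)⁻¹, δ̄^{κℓ} = φ^κ δ^ℓ N_p(ζ^κ; C x̂^ℓ + μ^κ, R + C Σ^ℓ Cᵀ), x̂^{κℓ} = x̂^ℓ + K^ℓ (ζ^κ − C x̂^ℓ − μ^κ), and Σ^{κℓ} = (I_n − K^ℓ C) Σ^ℓ. Then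 each Σ^{κℓ} is symmetric positive definite, and for every x ∈ ℝ^n, (Σ_{κ=1}^{K₀} φ^κ N_p(ζ^κ; C x + μ^κ, R)) · (Σ_{ℓ=1}^{M} δ^ℓ N_n(x; x̂^ℓ, Σ^ℓ)) = Σ_{κ=1}^{K₀} Σ_{ℓ=1}^{M} δ̄^{κℓ} N_n(x; x̂^{κℓ}, Σ^{κℓ}). -/
open Matrix Real

section InformationForm

variable {m n : Type*} [Fintype m] [Fintype n] {R : Matrix m m ℝ} {S : Matrix n n ℝ}

theorem dotProduct_mulVec_eq_transpose (A : Matrix m n ℝ) (a : m → ℝ) (b : n → ℝ) :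
    a ⬝ᵥ A *ᵥ b = (Aᵀ *ᵥ a) ⬝ᵥ b := by
  rw [dotProduct_mulVec, mulVec_transpose]

theorem Matrix.PosDef.add_mul_mul_transpose (hR : R.PosDef) (hS : S.PosDef) (C : Matrix m n ℝ) :
    (R + C * S * Cᵀ).PosDef := by
  have h := hS.posSemidef.mul_mul_conjTranspose_same C
  rw [conjTranspose_eq_transpose_of_trivial] at h
  exact hR.add_posSemidef h

variable [DecidableEq m] [DecidableEq n]

theorem Matrix.PosDef.inv_add_transpose_mul_inv_mul (hR : R.PosDef) (hS : S.PosDef)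
    (C : Matrix m n ℝ) : (S⁻¹ + Cᵀ * R⁻¹ * C).PosDef := by
  simpa using hS.inv.add_mul_mul_transpose hR.inv Cᵀ

/-- The Kalman posterior covariance is the inverse of the posterior information matrix. -/
theorem posterior_covariance_eq_inv (hR : R.PosDef) (hS : S.PosDef) (C : Matrix m n ℝ) :
    (1 - S * Cᵀ * (R + C * S * Cᵀ)⁻¹ * C) * S = (S⁻¹ + Cᵀ * R⁻¹ * C)⁻¹ := by
  have hP := (hR.inv_add_transpose_mul_inv_mul hS C).isUnit
  have hT := (hR.add_mul_mul_transpose hS C).isUnit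
  have hRu := hR.isUnit
  have hSu := hS.isUnit
  rw [isUnit_iff_isUnit_det] at hP hT hRu hSu
  symm
  apply inv_eq_right_inv
  have gain : (S⁻¹ + Cᵀ * R⁻¹ * C) * (S * Cᵀ * (R + C * S * Cᵀ)⁻¹) = Cᵀ * R⁻¹ := by
    have h : (S⁻¹ + Cᵀ * R⁻¹ * C) * (S * Cᵀ) = Cᵀ * R⁻¹ * (R + C * S * Cᵀ) := by
      rw [Matrix.add_mul, Matrix.mul_add, nonsing_inv_mul_cancel_left _ _ hSu,
        nonsing_inv_mul_cancel_right _ _ hRu]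
      simp only [Matrix.mul_assoc]
    rw [← Matrix.mul_assoc, h, mul_nonsing_inv_cancel_right _ _ hT]
  rw [← Matrix.mul_assoc, Matrix.mul_sub, ← Matrix.mul_assoc, gain, Matrix.mul_one,
    add_sub_cancel_right, nonsing_inv_mul _ hSu]

theorem det_mul_det_eq_innovation (hR : R.PosDef) (hS : S.PosDef) (C : Matrix m n ℝ) :
    R.det * S.det = (R + C * S * Cᵀ).det * ((S⁻¹ + Cᵀ * R⁻¹ * C)⁻¹).det := by
  have hP := (hR.inv_add_transpose_mul_inv_mul hS C).det_pos.ne'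
  have hRu := hR.isUnit
  have hSu := hS.isUnit
  rw [isUnit_iff_isUnit_det] at hRu hSu
  have h₁ : R + C * S * Cᵀ = R * (1 + (R⁻¹ * C) * (S * Cᵀ)) := by
    rw [Matrix.mul_add, Matrix.mul_one, Matrix.mul_assoc R⁻¹,
      mul_nonsing_inv_cancel_left _ _ hRu, Matrix.mul_assoc]
  have h₂ : S * (S⁻¹ + Cᵀ * R⁻¹ * C) = 1 + (S * Cᵀ) * (R⁻¹ * C) := by
    rw [Matrix.mul_add, mul_nonsing_inv _ hSu]
    simp only [Matrix.mul_assoc]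
  have h₃ := congrArg det h₂
  rw [det_mul] at h₃
  rw [h₁, det_mul, det_one_add_mul_comm, ← h₃, det_nonsing_inv, Ring.inverse_eq_inv']
  field_simp

/-- Completing the square. -/
theorem quadratic_form_add_eq (hR : R.PosDef) (hS : S.PosDef) (C : Matrix m n ℝ)
    (d : n → ℝ) (v : m → ℝ) :
    (v - C *ᵥ d) ⬝ᵥ R⁻¹ *ᵥ (v - C *ᵥ d) + d ⬝ᵥ S⁻¹ *ᵥ d =
      v ⬝ᵥ (R + C * S * Cᵀ)⁻¹ *ᵥ v +
        (d - (S * Cᵀ * (R + C * S * Cᵀ)⁻¹) *ᵥ v) ⬝ᵥ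
          (S⁻¹ + Cᵀ * R⁻¹ * C) *ᵥ (d - (S * Cᵀ * (R + C * S * Cᵀ)⁻¹) *ᵥ v) := by
  have hT := (hR.add_mul_mul_transpose hS C).isUnit
  have hRu := hR.isUnit
  have hSu := hS.isUnit
  rw [isUnit_iff_isUnit_det] at hT hRu hSu
  have hRt : Rᵀ = R := by simpa using hR.isHermitian.eq
  have hSt : Sᵀ = S := by simpa using hS.isHermitian.eq
  obtain ⟨w, rfl⟩ : ∃ w, v = (R + C * S * Cᵀ) *ᵥ w :=
    ⟨(R + C * S * Cᵀ)⁻¹ *ᵥ v, by rw [mulVec_mulVec, mul_nonsing_inv _ hT, one_mulVec]⟩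
  obtain ⟨e, rfl⟩ : ∃ e, d = e + (S * Cᵀ) *ᵥ w := ⟨d - (S * Cᵀ) *ᵥ w, by simp⟩
  have hres : (R + C * S * Cᵀ) *ᵥ w - C *ᵥ (e + (S * Cᵀ) *ᵥ w) = R *ᵥ w - C *ᵥ e := by
    rw [mulVec_add, mulVec_mulVec, add_mulVec, Matrix.mul_assoc]
    abel
  have hgain : (S * Cᵀ * (R + C * S * Cᵀ)⁻¹) *ᵥ (R + C * S * Cᵀ) *ᵥ w = (S * Cᵀ) *ᵥ w := by
    rw [mulVec_mulVec, nonsing_inv_mul_cancel_right _ _ hT]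
  have hinv : (R + C * S * Cᵀ)⁻¹ *ᵥ (R + C * S * Cᵀ) *ᵥ w = w := by
    rw [mulVec_mulVec, nonsing_inv_mul _ hT, one_mulVec]
  have hRw : R⁻¹ *ᵥ R *ᵥ w = w := by rw [mulVec_mulVec, nonsing_inv_mul _ hRu, one_mulVec]
  have hSw (u : n → ℝ) : S⁻¹ *ᵥ S *ᵥ u = u := by
    rw [mulVec_mulVec, nonsing_inv_mul _ hSu, one_mulVec]
  have hRR : R *ᵥ w ⬝ᵥ R⁻¹ *ᵥ C *ᵥ e = Cᵀ *ᵥ w ⬝ᵥ e := by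
    rw [dotProduct_mulVec_eq_transpose R⁻¹, transpose_nonsing_inv, hRt, hRw,
      dotProduct_mulVec, mulVec_transpose]
  have hSS : S *ᵥ Cᵀ *ᵥ w ⬝ᵥ S⁻¹ *ᵥ e = Cᵀ *ᵥ w ⬝ᵥ e := by
    rw [dotProduct_mulVec_eq_transpose S⁻¹, transpose_nonsing_inv, hSt, hSw]
  have hCw : C *ᵥ e ⬝ᵥ w = Cᵀ *ᵥ w ⬝ᵥ e := by
    rw [dotProduct_comm, dotProduct_mulVec_eq_transpose C]
  have hCR : e ⬝ᵥ Cᵀ *ᵥ R⁻¹ *ᵥ C *ᵥ e = C *ᵥ e ⬝ᵥ R⁻¹ *ᵥ C *ᵥ e := by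
    rw [dotProduct_mulVec_eq_transpose Cᵀ, transpose_transpose]
  have hCS : C *ᵥ S *ᵥ Cᵀ *ᵥ w ⬝ᵥ w = S *ᵥ Cᵀ *ᵥ w ⬝ᵥ Cᵀ *ᵥ w := by
    rw [dotProduct_mulVec_eq_transpose Cᵀ, transpose_transpose]
  rw [hres, hgain, hinv, add_sub_cancel_right]
  simp only [← mulVec_mulVec, mulVec_add, mulVec_sub, add_mulVec, dotProduct_add, add_dotProduct,
    sub_dotProduct, dotProduct_sub, hRw, hSw, hRR, hSS, hCw, hCR, hCS]
  rw [dotProduct_comm e (Cᵀ *ᵥ w)]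
  ring

theorem gaussianPDF_mul_gaussianPDF (hR : R.PosDef) (hS : S.PosDef) (C : Matrix m n ℝ)
    (x a : n → ℝ) (z b : m → ℝ) :
    gaussianPDF z (C *ᵥ x + b) R * gaussianPDF x a S =
      gaussianPDF z (C *ᵥ a + b) (R + C * S * Cᵀ) *
        gaussianPDF x (a + (S * Cᵀ * (R + C * S * Cᵀ)⁻¹) *ᵥ (z - C *ᵥ a - b))
          ((1 - S * Cᵀ * (R + C * S * Cᵀ)⁻¹ * C) * S) := by
  have hP := hR.inv_add_transpose_mul_inv_mul hS C
  have hT := hR.add_mul_mul_transpose hS C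
  have hdet := congrArg (· ^ (-(1 : ℝ) / 2)) (det_mul_det_eq_innovation hR hS C)
  simp only [mul_rpow hR.det_pos.le hS.det_pos.le,
    mul_rpow hT.det_pos.le hP.inv.det_pos.le] at hdet
  have hq := quadratic_form_add_eq hR hS C (x - a) (z - C *ᵥ a - b)
  have hexp := congrArg (fun t => exp (-(1 / 2) * t)) hq
  simp only [mul_add, exp_add] at hexp
  rw [posterior_covariance_eq_inv hR hS C]
  simp only [gaussianPDF]
  rw [nonsing_inv_nonsing_inv _ ((isUnit_iff_isUnit_det _).1 hP.isUnit)]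
  have e₁ : z - (C *ᵥ x + b) = z - C *ᵥ a - b - C *ᵥ (x - a) := by
    rw [mulVec_sub]
    abel
  rw [e₁, ← sub_sub z, ← sub_sub x]
  linear_combination
    (2 * π) ^ (-(Fintype.card m : ℝ) / 2) * (2 * π) ^ (-(Fintype.card n : ℝ) / 2) *
      (R.det ^ (-(1 : ℝ) / 2) * S.det ^ (-(1 : ℝ) / 2)) * hexp +
    (2 * π) ^ (-(Fintype.card m : ℝ) / 2) * (2 * π) ^ (-(Fintype.card n : ℝ) / 2) *
      (exp (-(1 / 2) * ((z - C *ᵥ a - b) ⬝ᵥ (R + C * S * Cᵀ)⁻¹ *ᵥ (z - C *ᵥ a - b))) *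
        exp (-(1 / 2) * ((x - a - (S * Cᵀ * (R + C * S * Cᵀ)⁻¹) *ᵥ (z - C *ᵥ a - b)) ⬝ᵥ
          (S⁻¹ + Cᵀ * R⁻¹ * C) *ᵥ
            (x - a - (S * Cᵀ * (R + C * S * Cᵀ)⁻¹) *ᵥ (z - C *ᵥ a - b))))) * hdet

end InformationForm

/-- Gaussian-mixture measurement update (measurement-update step of the Gaussian
sum filter). -/
theorem gaussian_mixture_measurement_update
    (n p : ℕ) (hn : 0 < n) (hp : 0 < p)
    (R : Matrix (Fin p) (Fin p) ℝ) (hR : R.PosDef)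
    (C : Matrix (Fin p) (Fin n) ℝ)
    (K₀ M : ℕ) (hK₀ : 0 < K₀) (hM : 0 < M)
    (φ : Fin K₀ → ℝ) (hφ : ∀ κ, 0 < φ κ)
    (μ : Fin K₀ → Fin p → ℝ) (ζ : Fin K₀ → Fin p → ℝ)
    (δ : Fin M → ℝ) (hδ : ∀ ℓ, 0 < δ ℓ)
    (xhat : Fin M → Fin n → ℝ)
    (Sig : Fin M → Matrix (Fin n) (Fin n) ℝ) (hSig : ∀ ℓ, (Sig ℓ).PosDef)
    (K : Fin M → Matrix (Fin n) (Fin p) ℝ)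
    (hK : ∀ ℓ, K ℓ = Sig ℓ * Cᵀ * (R + C * Sig ℓ * Cᵀ)⁻¹)
    (δ' : Fin K₀ → Fin M → ℝ)
    (hδ' : ∀ κ ℓ, δ' κ ℓ =
      φ κ * δ ℓ * gaussianPDF (ζ κ) (C *ᵥ xhat ℓ + μ κ) (R + C * Sig ℓ * Cᵀ))
    (xhat' : Fin K₀ → Fin M → Fin n → ℝ)
    (hxhat' : ∀ κ ℓ, xhat' κ ℓ = xhat ℓ + K ℓ *ᵥ (ζ κ - C *ᵥ xhat ℓ - μ κ))
    (Sig' : Fin K₀ → Fin M → Matrix (Fin n) (Fin n) ℝ)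
    (hSig' : ∀ κ ℓ, Sig' κ ℓ = (1 - K ℓ * C) * Sig ℓ) :
    (∀ κ ℓ, (Sig' κ ℓ).PosDef) ∧
      ∀ x : Fin n → ℝ,
        (∑ κ, φ κ * gaussianPDF (ζ κ) (C *ᵥ x + μ κ) R) *
            (∑ ℓ, δ ℓ * gaussianPDF x (xhat ℓ) (Sig ℓ)) =
          ∑ κ, ∑ ℓ, δ' κ ℓ * gaussianPDF x (xhat' κ ℓ) (Sig' κ ℓ) := by
  refine ⟨fun κ ℓ => ?_, fun x => ?_⟩
  · rw [hSig', hK, posterior_covariance_eq_inv hR (hSig ℓ)]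
    exact (hR.inv_add_transpose_mul_inv_mul (hSig ℓ) C).inv
  · rw [Finset.sum_mul_sum]
    refine Finset.sum_congr rfl fun κ _ => Finset.sum_congr rfl fun ℓ _ => ?_
    rw [hδ', hxhat', hSig', hK, mul_mul_mul_comm, gaussianPDF_mul_gaussianPDF hR (hSig ℓ),
      mul_assoc (φ κ * δ ℓ)]
end
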